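/- arXiv:1401.6981 — 9 statements merged into one kernel-verified Lean document; each statement's English description precedes it below -/
import Mathlib

section
/- Let G be a simple graph, let s be a vertex, and let {u1,u2} be an edge of G such that edist_G(s,u1) = edist_G(s,u2) and this common value is finite. Let G' = G − {u1,u2}. Then for every vertex t, edist_{G'}(s,t) = edist_G(s,t) and σ_{G'}(s,t) = σ_G(s,t). -/
open SimpleGraph

/-- The number of shortest paths from `x` to `y` in `G`: walks whose length equals the
extended distance `G.edist x y`. -/
noncomputable def numSP {V : Type*} (G : SimpleGraph V) (x y : V) : ℕ :=
  Nat.card {p : G.Walk x y // (p.length : ℕ∞) = G.edist x y}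

/-- The number of shortest paths from `x` to `y` in `G` that contain `v` as an internal
vertex. -/
noncomputable def numSPviaV {V : Type*} (G : SimpleGraph V) (x y v : V) : ℕ :=
  Nat.card {p : G.Walk x y //
    (p.length : ℕ∞) = G.edist x y ∧ v ∈ p.support ∧ v ≠ x ∧ v ≠ y}

/-- The number of shortest paths from `x` to `y` in `G` that traverse the edge `e`. -/
noncomputable def numSPviaE {V : Type*} (G : SimpleGraph V) (x y : V) (e : Sym2 V) : ℕ :=
  Nat.card {p : G.Walk x y // (p.length : ℕ∞) = G.edist x y ∧ e ∈ p.edges}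

/-- The graph `G` with the edge `{a,b}` added. -/
def addEdge {V : Type*} (G : SimpleGraph V) (a b : V) : SimpleGraph V :=
  G ⊔ SimpleGraph.edge a b

/-- A walk using an edge whose endpoints are equidistant from `s` wastes at least one step, as
measured by the distance from `s`. -/
theorem edist_add_one_le_of_mem_edges {V : Type*} {G : SimpleGraph V} {s u₁ u₂ : V}
    (heq : G.edist s u₁ = G.edist s u₂) {a t : V} (p : G.Walk a t) (he : s(u₁, u₂) ∈ p.edges) :
    G.edist s t + 1 ≤ G.edist s a + p.length := by
  induction p with
  | nil => simp at he
  | @cons a b t h q ih =>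
    rw [Walk.length_cons, Nat.cast_add, Nat.cast_one, ← add_assoc]
    rw [Walk.edges_cons, List.mem_cons] at he
    rcases he with he | he
    · have hab : G.edist s b = G.edist s a := by
        rcases Sym2.eq_iff.mp he with ⟨rfl, rfl⟩ | ⟨rfl, rfl⟩
        exacts [heq.symm, heq]
      rw [← hab]
      gcongr
      exact G.edist_triangle.trans (by gcongr; exact edist_le q)
    · calc G.edist s t + 1 ≤ G.edist s b + q.length := ih he
        _ ≤ G.edist s a + 1 + q.length := by
          gcongr
          exact G.edist_triangle.trans (by rw [edist_eq_one_iff_adj.mpr h])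
        _ = G.edist s a + q.length + 1 := add_right_comm _ _ _

/-- A shortest path from `s` avoids every edge whose endpoints are equidistant from `s`. -/
theorem notMem_edges_of_length_eq_edist {V : Type*} {G : SimpleGraph V} {s u₁ u₂ t : V}
    (heq : G.edist s u₁ = G.edist s u₂) (p : G.Walk s t) (hp : (p.length : ℕ∞) = G.edist s t) :
    s(u₁, u₂) ∉ p.edges := fun he => by
  have h := edist_add_one_le_of_mem_edges heq p he
  rw [← hp, edist_self, zero_add] at h
  norm_cast at h
  omega

/-- Deleting an edge `{u1,u2}` whose endpoints are at the same finite distance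
from `s` changes neither distances from `s` nor the numbers of shortest paths from `s`. -/
theorem stmt_1 {V : Type*} (G : SimpleGraph V) (s u1 u2 : V)
    (hadj : G.Adj u1 u2)
    (heq : G.edist s u1 = G.edist s u2) (hfin : G.edist s u1 ≠ ⊤) :
    ∀ t : V, (G.deleteEdges {s(u1, u2)}).edist s t = G.edist s t ∧
      numSP (G.deleteEdges {s(u1, u2)}) s t = numSP G s t := by
  intro t
  have hle : G.deleteEdges {s(u1, u2)} ≤ G := G.deleteEdges_le _
  have hdist : (G.deleteEdges {s(u1, u2)}).edist s t = G.edist s t := by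
    refine le_antisymm ?_ (edist_anti hle)
    by_cases hr : G.Reachable s t
    · obtain ⟨p, hp⟩ := hr.exists_walk_length_eq_edist
      rw [← hp, ← Walk.length_transfer p]
      exact edist_le (p.toDeleteEdge _ (notMem_edges_of_length_eq_edist heq p hp))
    · rw [edist_eq_top_of_not_reachable hr]
      exact le_top
  refine ⟨hdist, Nat.card_eq_of_bijective
    (fun p => ⟨p.1.map (.ofLE hle), by rw [Walk.length_map, p.2, hdist]⟩) ⟨?_, ?_⟩⟩
  · intro p q hpq
    exact Subtype.ext (Walk.map_injective_of_injective Function.injective_id s t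
      (congrArg Subtype.val hpq))
  · rintro ⟨p, hp⟩
    have havoid : ∀ e ∈ p.edges, e ∉ ({s(u1, u2)} : Set (Sym2 V)) := by
      rintro _ he rfl
      exact notMem_edges_of_length_eq_edist heq p hp he
    refine ⟨⟨p.toDeleteEdges _ havoid, ?_⟩, ?_⟩
    · rw [Walk.length_transfer, hp, hdist]
    · exact Subtype.ext (Walk.map_toDeleteEdges_eq _ havoid)
end

section
/- Let G be a simple graph, let s be a vertex, and let u1, u2 be distinct nonadjacent vertices of G such that edist_G(s,u1) = edist_G(s,u2) and this common value is finite. Let G' = G + {u1,u2}. Then for every vertex t, edist_{G'}(s,t) = edist_G(s,t) and σ_{G'}(s,t) = σ_G(s,t). -/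
open SimpleGraph

namespace SimpleGraph

variable {V : Type*} {G H : SimpleGraph V} {s : V}

lemma edist_le_edist_add_one {a b : V} (h : G.Adj a b) : G.edist s b ≤ G.edist s a + 1 := by
  rw [← edist_eq_one_iff_adj.mpr h]
  exact G.edist_triangle

/-- If every edge of `H` outside `G` joins vertices equidistant from `s` in `G`, then a walk in `H`
that uses such an edge is strictly longer than the increase of the distance from `s`. -/
lemma Walk.edges_subset_or_edist_add_one_le
    (hH : ∀ a b, H.Adj a b → ¬ G.Adj a b → G.edist s a = G.edist s b) {x t : V} (p : H.Walk x t) :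
    G.edist s t ≤ G.edist s x + p.length ∧
      ((∀ e ∈ p.edges, e ∈ G.edgeSet) ∨ G.edist s t + 1 ≤ G.edist s x + p.length) := by
  induction p with
  | nil => simp
  | @cons x y t h q ih =>
    obtain ⟨hle, hor⟩ := ih
    simp only [Walk.length_cons, Walk.edges_cons, List.mem_cons, forall_eq_or_imp]
    push_cast
    by_cases hG : G.Adj x y
    · have hxy : G.edist s y + q.length ≤ G.edist s x + (q.length + 1) := by
        rw [add_comm (q.length : ℕ∞), ← add_assoc]
        gcongr
        exact edist_le_edist_add_one hG
      exact ⟨hle.trans hxy, hor.imp (⟨hG, ·⟩) (·.trans hxy)⟩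
    · have hlt : G.edist s t + 1 ≤ G.edist s x + (q.length + 1) := by
        rw [hH x y h hG, ← add_assoc]
        gcongr
      exact ⟨le_self_add.trans hlt, .inr hlt⟩

lemma edist_eq_of_le_of_forall_edist_eq (hle : G ≤ H)
    (hH : ∀ a b, H.Adj a b → ¬ G.Adj a b → G.edist s a = G.edist s b) (t : V) :
    H.edist s t = G.edist s t := by
  refine le_antisymm (edist_anti hle) (le_iInf fun p ↦ ?_)
  simpa using (p.edges_subset_or_edist_add_one_le hH).1

lemma numSP_eq_of_le_of_forall_edist_eq (hle : G ≤ H)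
    (hH : ∀ a b, H.Adj a b → ¬ G.Adj a b → G.edist s a = G.edist s b) (t : V) :
    numSP H s t = numSP G s t := by
  have hd := edist_eq_of_le_of_forall_edist_eq hle hH t
  refine (Nat.card_congr (Equiv.ofBijective
    (fun p : {p : G.Walk s t // (p.length : ℕ∞) = G.edist s t} ↦
      (⟨p.1.mapLe hle, by simpa [hd] using p.2⟩ :
        {p : H.Walk s t // (p.length : ℕ∞) = H.edist s t})) ⟨?_, ?_⟩)).symm
  · intro p q hpq
    exact Subtype.ext (Walk.map_injective_of_injective (f := .ofLE hle) Function.injective_id s t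
      (congrArg Subtype.val hpq))
  · rintro ⟨q, hq⟩
    have hG : ∀ e ∈ q.edges, e ∈ G.edgeSet := by
      refine (q.edges_subset_or_edist_add_one_le hH).2.resolve_right fun hlt ↦ ?_
      rw [← hd, ← hq, edist_self, zero_add] at hlt
      norm_cast at hlt
      omega
    refine ⟨⟨q.transfer G hG, by simpa [hd] using hq⟩, Subtype.ext ?_⟩
    change (q.transfer G hG).map (.ofLE hle) = q
    rw [← Walk.transfer_eq_map_ofLE _ fun e he ↦
        edgeSet_mono hle ((q.transfer G hG).edges_subset_edgeSet he),
      Walk.transfer_transfer, Walk.transfer_self]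

end SimpleGraph

/-- Adding an edge between two distinct nonadjacent vertices at the same finite
distance from `s` changes neither distances from `s` nor the numbers of shortest paths
from `s`. -/
theorem stmt_2 {V : Type*} (G : SimpleGraph V) (s u1 u2 : V)
    (hne : u1 ≠ u2) (hnadj : ¬ G.Adj u1 u2)
    (heq : G.edist s u1 = G.edist s u2) (hfin : G.edist s u1 ≠ ⊤) :
    ∀ t : V, (addEdge G u1 u2).edist s t = G.edist s t ∧
      numSP (addEdge G u1 u2) s t = numSP G s t := by
  have hle : G ≤ addEdge G u1 u2 := le_sup_left
  have hH : ∀ a b, (addEdge G u1 u2).Adj a b → ¬ G.Adj a b → G.edist s a = G.edist s b := by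
    intro a b hab hG
    obtain ⟨⟨rfl, rfl⟩ | ⟨rfl, rfl⟩, -⟩ := (edge_adj ..).mp (hab.resolve_left hG)
    exacts [heq, heq.symm]
  exact fun t ↦ ⟨edist_eq_of_le_of_forall_edist_eq hle hH t,
    numSP_eq_of_le_of_forall_edist_eq hle hH t⟩
end

section
/- Let G be a simple graph, let s be a vertex, and let u_H, u_L be distinct nonadjacent vertices with edist_G(s,u_H) finite and edist_G(s,u_L) = edist_G(s,u_H) + 1. Let G' = G + {u_H,u_L}. Then for every vertex t, edist_{G'}(s,t) = edist_G(s,t). -/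
open SimpleGraph

/-- If `G.edist s` grows by at most one along each edge of `H`, then it grows by at most
the length along each walk of `H`. -/
theorem edist_le_edist_add_length {V : Type*} {G H : SimpleGraph V} {s : V}
    (h : ∀ a b, H.Adj a b → G.edist s b ≤ G.edist s a + 1) {u v : V} (p : H.Walk u v) :
    G.edist s v ≤ G.edist s u + p.length := by
  induction p with
  | nil => simp
  | cons hadj p ih =>
    calc G.edist s _ ≤ _ := ih
      _ ≤ _ := add_le_add_left (h _ _ hadj) _
      _ = _ := by rw [Walk.length_cons, Nat.cast_add, Nat.cast_one, add_assoc, add_comm 1]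

/-- If `G.edist s` grows by at most one along each edge of `H`, then it is at most
`H.edist s`. -/
theorem edist_le_edist_of_adj {V : Type*} {G H : SimpleGraph V} {s : V}
    (h : ∀ a b, H.Adj a b → G.edist s b ≤ G.edist s a + 1) (t : V) :
    G.edist s t ≤ H.edist s t :=
  le_iInf fun p => by simpa using edist_le_edist_add_length h p

/-- Adding an edge `{u_H,u_L}` with `edist(s,u_L) = edist(s,u_H) + 1` (the
latter finite) does not change any distance from `s`. -/
theorem stmt_4 {V : Type*} (G : SimpleGraph V) (s uH uL : V)
    (hne : uH ≠ uL) (hnadj : ¬ G.Adj uH uL)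
    (hH : G.edist s uH ≠ ⊤) (hL : G.edist s uL = G.edist s uH + 1) :
    ∀ t : V, (addEdge G uH uL).edist s t = G.edist s t := by
  intro t
  refine le_antisymm (edist_anti le_sup_left) (edist_le_edist_of_adj ?_ t)
  rintro a b (hab | hab)
  · exact SimpleGraph.edist_triangle.trans_eq (by rw [edist_eq_one_iff_adj.mpr hab])
  · rw [SimpleGraph.edge_adj] at hab
    obtain ⟨⟨rfl, rfl⟩ | ⟨rfl, rfl⟩, -⟩ := hab
    · exact hL.le
    · rw [hL]
      exact le_self_add.trans le_self_add
end

section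
/- Let G be a simple graph, let {u,v} be an edge of G, and let s, t be vertices. Then: (i) at most one of the two conditions 'edist_G(s,u) + 1 + edist_G(v,t) = edist_G(s,t) with edist_G(s,t) finite' and 'edist_G(s,v) + 1 + edist_G(u,t) = edist_G(s,t) with edist_G(s,t) finite' holds; (ii) if the first condition holds then σ_G(s,t | {u,v}) = σ_G(s,u) · σ_G(v,t); (iii) if the second condition holds then σ_G(s,t | {u,v}) = σ_G(s,v) · σ_G(u,t); (iv) if neither holds then σ_G(s,t | {u,v}) = 0. -/
open SimpleGraph

namespace SimpleGraph

variable {V : Type*} {G : SimpleGraph V}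

/-- A walk through an edge splits at that edge, in one of the two directions. -/
theorem Walk.exists_eq_append_cons_of_mem_edges {u v : V} (h : G.Adj u v) {s t : V}
    (p : G.Walk s t) (hp : s(u, v) ∈ p.edges) :
    (∃ (q : G.Walk s u) (r : G.Walk v t), p = q.append (.cons h r)) ∨
      ∃ (q : G.Walk s v) (r : G.Walk u t), p = q.append (.cons h.symm r) := by
  induction p with
  | nil => simp at hp
  | cons hadj p ih =>
    rw [Walk.edges_cons, List.mem_cons] at hp
    rcases hp with hp | hp
    · rcases Sym2.eq_iff.mp hp with ⟨rfl, rfl⟩ | ⟨rfl, rfl⟩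
      · exact .inl ⟨.nil, p, rfl⟩
      · exact .inr ⟨.nil, p, rfl⟩
    · rcases ih hp with ⟨q, r, rfl⟩ | ⟨q, r, rfl⟩
      · exact .inl ⟨.cons hadj q, r, rfl⟩
      · exact .inr ⟨.cons hadj q, r, rfl⟩

theorem Walk.append_cons_inj {s u v t : V} {h : G.Adj u v} {q q' : G.Walk s u}
    {r r' : G.Walk v t} (hlen : q.length = q'.length)
    (heq : q.append (.cons h r) = q'.append (.cons h r')) : q = q' ∧ r = r' := by
  have hs := congrArg Walk.support heq
  rw [Walk.support_append, Walk.support_append] at hs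
  obtain ⟨hq, hr⟩ := List.append_inj hs (by simp [hlen])
  exact ⟨Walk.ext_support hq, Walk.ext_support (by simpa using hr)⟩

theorem edist_le_edist_add_one_add_edist {u v : V} (h : G.Adj u v) (s t : V) :
    G.edist s t ≤ G.edist s u + 1 + G.edist v t :=
  calc G.edist s t ≤ G.edist s v + G.edist v t := G.edist_triangle
    _ ≤ G.edist s u + G.edist u v + G.edist v t := by gcongr; exact G.edist_triangle
    _ = G.edist s u + 1 + G.edist v t := by rw [edist_eq_one_iff_adj.mpr h]

theorem Walk.edist_add_one_add_edist_of_length_append_cons {s u v t : V} (h : G.Adj u v)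
    (q : G.Walk s u) (r : G.Walk v t)
    (hp : ((q.append (.cons h r)).length : ℕ∞) = G.edist s t) :
    G.edist s u + 1 + G.edist v t = G.edist s t ∧ G.edist s t ≠ ⊤ := by
  refine ⟨le_antisymm ?_ (edist_le_edist_add_one_add_edist h s t), hp ▸ ENat.natCast_ne_top _⟩
  calc G.edist s u + 1 + G.edist v t ≤ q.length + 1 + r.length := by
        gcongr <;> exact Walk.edist_le _
    _ = G.edist s t := by
        rw [← hp, Walk.length_append, Walk.length_cons]; push_cast; ring

/-- A shortest path cannot use the same edge in both directions. -/
theorem not_edist_add_one_add_edist_eq_both {s t u v : V}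
    (h₁ : G.edist s u + 1 + G.edist v t = G.edist s t) (hfin : G.edist s t ≠ ⊤)
    (h₂ : G.edist s v + 1 + G.edist u t = G.edist s t) : False := by
  have hu : G.edist s t ≤ G.edist s u + G.edist u t := G.edist_triangle
  have hv : G.edist s t ≤ G.edist s v + G.edist v t := G.edist_triangle
  generalize G.edist s t = d, G.edist s u = a, G.edist v t = b, G.edist s v = c,
    G.edist u t = e at *
  subst h₁
  have hfin' := h₂ ▸ hfin
  simp only [ne_eq, ENat.add_eq_top, not_or] at hfin hfin'
  lift a to ℕ using hfin.1.1
  lift b to ℕ using hfin.2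
  lift c to ℕ using hfin'.1.1
  lift e to ℕ using hfin'.2
  norm_cast at *
  omega

theorem Walk.length_eq_edist_of_length_append_cons {s u v t : V} {h : G.Adj u v}
    {q : G.Walk s u} {r : G.Walk v t}
    (hd : G.edist s u + 1 + G.edist v t = G.edist s t)
    (hp : ((q.append (.cons h r)).length : ℕ∞) = G.edist s t) :
    (q.length : ℕ∞) = G.edist s u ∧ (r.length : ℕ∞) = G.edist v t := by
  have hq := q.edist_le
  have hr := r.edist_le
  rw [← hd, Walk.length_append, Walk.length_cons] at hp
  generalize G.edist s u = a, G.edist v t = b at *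
  lift a to ℕ using ne_top_of_le_ne_top (ENat.natCast_ne_top _) hq
  lift b to ℕ using ne_top_of_le_ne_top (ENat.natCast_ne_top _) hr
  norm_cast at *
  omega

end SimpleGraph

theorem numSPviaE_eq_mul {V : Type*} {G : SimpleGraph V} {u v s t : V} (hadj : G.Adj u v)
    (hd : G.edist s u + 1 + G.edist v t = G.edist s t) (hfin : G.edist s t ≠ ⊤) :
    numSPviaE G s t s(u, v) = numSP G s u * numSP G v t := by
  unfold numSPviaE numSP
  rw [← Nat.card_prod]
  symm
  refine Nat.card_eq_of_bijective
    (fun x => ⟨x.1.1.append (.cons hadj x.2.1), ?_, by simp⟩) ⟨?_, ?_⟩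
  · obtain ⟨⟨q, hq⟩, ⟨r, hr⟩⟩ := x
    simp only [Walk.length_append, Walk.length_cons]
    rw [← hd, ← hq, ← hr]
    push_cast
    ring
  · rintro ⟨⟨q, hq⟩, ⟨r, hr⟩⟩ ⟨⟨q', hq'⟩, ⟨r', hr'⟩⟩ heq
    obtain ⟨rfl, rfl⟩ := Walk.append_cons_inj (by exact_mod_cast hq.trans hq'.symm)
      (congrArg Subtype.val heq)
    rfl
  · rintro ⟨p, hp, he⟩
    rcases p.exists_eq_append_cons_of_mem_edges hadj he with ⟨q, r, rfl⟩ | ⟨q, r, rfl⟩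
    · obtain ⟨hq, hr⟩ := Walk.length_eq_edist_of_length_append_cons hd hp
      exact ⟨⟨⟨q, hq⟩, ⟨r, hr⟩⟩, rfl⟩
    · exact (not_edist_add_one_add_edist_eq_both hd hfin
        (q.edist_add_one_add_edist_of_length_append_cons hadj.symm r hp).1).elim

/-- For an edge `{u,v}` of `G` and vertices `s`, `t`: at most one of the two
orientation conditions holds, and the number of shortest paths from `s` to `t` traversing
`{u,v}` is determined accordingly. -/
theorem stmt_7 {V : Type*} (G : SimpleGraph V) (u v s t : V) (hadj : G.Adj u v) :
    (¬ ((G.edist s u + 1 + G.edist v t = G.edist s t ∧ G.edist s t ≠ ⊤) ∧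
        (G.edist s v + 1 + G.edist u t = G.edist s t ∧ G.edist s t ≠ ⊤))) ∧
    ((G.edist s u + 1 + G.edist v t = G.edist s t ∧ G.edist s t ≠ ⊤) →
      numSPviaE G s t s(u, v) = numSP G s u * numSP G v t) ∧
    ((G.edist s v + 1 + G.edist u t = G.edist s t ∧ G.edist s t ≠ ⊤) →
      numSPviaE G s t s(u, v) = numSP G s v * numSP G u t) ∧
    (¬ (G.edist s u + 1 + G.edist v t = G.edist s t ∧ G.edist s t ≠ ⊤) →
      ¬ (G.edist s v + 1 + G.edist u t = G.edist s t ∧ G.edist s t ≠ ⊤) →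
      numSPviaE G s t s(u, v) = 0) := by
  refine ⟨fun h => not_edist_add_one_add_edist_eq_both h.1.1 h.1.2 h.2.1,
    fun h => numSPviaE_eq_mul hadj h.1 h.2,
    fun h => Sym2.eq_swap (a := u) (b := v) ▸ numSPviaE_eq_mul hadj.symm h.1 h.2,
    fun h₁ h₂ => ?_⟩
  refine @Nat.card_of_isEmpty _ ⟨?_⟩
  rintro ⟨p, hp, he⟩
  rcases p.exists_eq_append_cons_of_mem_edges hadj he with ⟨q, r, rfl⟩ | ⟨q, r, rfl⟩
  · exact h₁ (q.edist_add_one_add_edist_of_length_append_cons hadj r hp)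
  · exact h₂ (q.edist_add_one_add_edist_of_length_append_cons hadj.symm r hp)
end

section
/- Let G be a simple graph and let s, t, v be vertices with v ∉ {s,t}. If edist_G(s,v) + edist_G(v,t) = edist_G(s,t) and edist_G(s,t) is finite, then σ_G(s,t | v) = σ_G(s,v) · σ_G(v,t); otherwise σ_G(s,t | v) = 0. -/
open SimpleGraph

/-- Two decompositions of a walk at the same vertex agree as soon as their first parts have
equal length. -/
theorem SimpleGraph.Walk.append_inj_of_length_eq {V : Type*} {G : SimpleGraph V} {s v t : V}
    (p p' : G.Walk s v) (q q' : G.Walk v t) (hl : p.length = p'.length)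
    (h : p.append q = p'.append q') : p = p' ∧ q = q' := by
  induction p with
  | nil =>
    cases p' with
    | nil => exact ⟨rfl, h⟩
    | cons _ _ => simp at hl
  | cons e p ih =>
    cases p' with
    | nil => simp at hl
    | cons e' p' =>
      simp only [Walk.cons_append, Walk.cons.injEq] at h
      obtain ⟨rfl, h⟩ := h
      obtain ⟨rfl, rfl⟩ := ih p' q q' (by simpa using hl) (eq_of_heq h)
      exact ⟨rfl, rfl⟩

/-- Both parts of a shortest path cut at one of its vertices are shortest paths. -/
theorem SimpleGraph.Walk.length_eq_edist_of_append {V : Type*} {G : SimpleGraph V} {s v t : V}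
    (p : G.Walk s v) (q : G.Walk v t) (h : ((p.append q).length : ℕ∞) = G.edist s t) :
    (p.length : ℕ∞) = G.edist s v ∧ (q.length : ℕ∞) = G.edist v t := by
  have hp := SimpleGraph.edist_le p
  have hq := SimpleGraph.edist_le q
  have ht : G.edist s t ≤ G.edist s v + G.edist v t := SimpleGraph.edist_triangle
  rw [← h, Walk.length_append] at ht
  obtain ⟨a, ha⟩ := ENat.ne_top_iff_exists.mp (ne_top_of_le_ne_top (ENat.natCast_ne_top _) hp)
  obtain ⟨b, hb⟩ := ENat.ne_top_iff_exists.mp (ne_top_of_le_ne_top (ENat.natCast_ne_top _) hq)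
  rw [← ha] at hp ht ⊢
  rw [← hb] at hq ht ⊢
  norm_cast at *
  omega

/-- For `v ∉ {s,t}`: if `edist(s,v) + edist(v,t) = edist(s,t)` with `edist(s,t)`
finite then `σ(s,t|v) = σ(s,v)·σ(v,t)`, and otherwise `σ(s,t|v) = 0`. -/
theorem stmt_8 {V : Type*} (G : SimpleGraph V) (s t v : V)
    (hvs : v ≠ s) (hvt : v ≠ t) :
    ((G.edist s v + G.edist v t = G.edist s t ∧ G.edist s t ≠ ⊤) →
      numSPviaV G s t v = numSP G s v * numSP G v t) ∧
    (¬ (G.edist s v + G.edist v t = G.edist s t ∧ G.edist s t ≠ ⊤) →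
      numSPviaV G s t v = 0) := by
  constructor
  · rintro ⟨hadd, -⟩
    unfold numSPviaV numSP
    rw [← Nat.card_prod]
    symm
    refine Nat.card_eq_of_bijective (fun x ↦ ⟨x.1.1.append x.2.1, ?_, ?_, hvs, hvt⟩) ⟨?_, ?_⟩
    · rw [Walk.length_append, Nat.cast_add, x.1.2, x.2.2, hadd]
    · simp [Walk.mem_support_append_iff]
    · rintro ⟨⟨p, hp⟩, ⟨q, hq⟩⟩ ⟨⟨p', hp'⟩, ⟨q', hq'⟩⟩ h
      obtain ⟨rfl, rfl⟩ := Walk.append_inj_of_length_eq p p' q q'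
        (by exact_mod_cast hp.trans hp'.symm) (congrArg Subtype.val h)
      rfl
    · rintro ⟨w, hw, hv, -⟩
      obtain ⟨p, q, rfl⟩ := Walk.mem_support_iff_exists_append.mp hv
      obtain ⟨hp, hq⟩ := Walk.length_eq_edist_of_append p q hw
      exact ⟨⟨⟨p, hp⟩, ⟨q, hq⟩⟩, rfl⟩
  · intro hn
    refine @Nat.card_of_isEmpty _ ⟨?_⟩
    rintro ⟨w, hw, hv, -⟩
    obtain ⟨p, q, rfl⟩ := Walk.mem_support_iff_exists_append.mp hv
    obtain ⟨hp, hq⟩ := Walk.length_eq_edist_of_append p q hw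
    refine hn ⟨?_, hw ▸ ENat.natCast_ne_top _⟩
    rw [← hp, ← hq, ← hw, Walk.length_append, Nat.cast_add]
end

section
/- Let G be a finite simple graph, let s be a vertex, and let v ≠ s be a vertex reachable from s. Then δ_s(v) = Σ_w (σ_G(s,v) / σ_G(s,w)) · (1 + δ_s(w)), where the sum ranges over all neighbors w of v with edist_G(s,w) = edist_G(s,v) + 1. -/
open SimpleGraph

open scoped Classical in
/-- The dependency of the source `s` on the vertex `v`:
`δ_s(v) = Σ_{t ∈ V, t ∉ {s,v}, σ(s,t) > 0} σ(s,t|v)/σ(s,t)`. -/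
noncomputable def dep {V : Type*} (G : SimpleGraph V) [Fintype V] (s v : V) : ℚ :=
  ∑ t : V, if t ≠ s ∧ t ≠ v ∧ 0 < numSP G s t
    then (numSPviaV G s t v : ℚ) / (numSP G s t : ℚ) else 0

/-- The number of shortest paths from `x` to `y` in `G` that contain `v`, possibly as an
endpoint. -/
noncomputable def numSPthrough {V : Type*} (G : SimpleGraph V) (x y v : V) : ℕ :=
  Nat.card {p : G.Walk x y // (p.length : ℕ∞) = G.edist x y ∧ v ∈ p.support}

section ShortestPathCounting

variable {V : Type*} (G : SimpleGraph V)

theorem numSPviaV_eq_numSPthrough {x y v : V} (hx : v ≠ x) (hy : v ≠ y) :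
    numSPviaV G x y v = numSPthrough G x y v := by
  simp [numSPviaV, numSPthrough, hx, hy]

theorem numSPthrough_end (x y : V) : numSPthrough G x y y = numSP G x y := by
  simp [numSP, numSPthrough]

theorem finite_shortestPaths [Finite V] (x y : V) :
    Finite {p : G.Walk x y // (p.length : ℕ∞) = G.edist x y} := by
  classical
  have := Fintype.ofFinite V
  by_cases h : G.Reachable x y
  · have hfin : {p : G.Walk x y | p.length = G.dist x y}.Finite := Set.toFinite _
    refine (hfin.subset fun p hp => ?_).to_subtype
    have hp : (p.length : ℕ∞) = G.edist x y := hp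
    rw [← h.coe_dist_eq_edist] at hp
    exact_mod_cast hp
  · have : IsEmpty (G.Walk x y) := not_nonempty_iff.1 h
    infer_instance

theorem numSP_pos [Finite V] {x y : V} (h : G.Reachable x y) : 0 < numSP G x y := by
  have := finite_shortestPaths G x y
  obtain ⟨p, hp⟩ := h.exists_walk_length_eq_edist
  have : Nonempty {p : G.Walk x y // (p.length : ℕ∞) = G.edist x y} := ⟨⟨p, hp⟩⟩
  exact Nat.card_pos

variable {G} in
theorem append_injective_of_length_eq {x v y : V} {p p' : G.Walk x v} {q q' : G.Walk v y}
    (hl : p.length = p'.length) (h : p.append q = p'.append q') : p = p' ∧ q = q' := by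
  have hs := congrArg Walk.support h
  rw [Walk.support_append, Walk.support_append] at hs
  obtain ⟨h₁, h₂⟩ := List.append_inj hs (by simp [hl])
  refine ⟨Walk.ext_support h₁, Walk.ext_support ?_⟩
  rw [← Walk.cons_tail_support, h₂, Walk.cons_tail_support]

theorem numSPthrough_eq_mul {x y v : V}
    (h : G.edist x v + G.edist v y = G.edist x y) :
    numSPthrough G x y v = numSP G x v * numSP G v y := by
  classical
  rw [numSP, numSP, ← Nat.card_prod]
  symm
  refine Nat.card_eq_of_bijective
    (fun pq => ⟨pq.1.1.append pq.2.1, by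
      rw [Walk.length_append, Nat.cast_add, pq.1.2, pq.2.2, h],
      by simp [Walk.mem_support_append_iff]⟩) ⟨?_, ?_⟩
  · rintro ⟨⟨p, hp⟩, ⟨q, hq⟩⟩ ⟨⟨p', hp'⟩, ⟨q', hq'⟩⟩ heq
    obtain ⟨rfl, rfl⟩ := append_injective_of_length_eq
      (by exact_mod_cast hp.trans hp'.symm) (congrArg Subtype.val heq)
    rfl
  · rintro ⟨p, hp, hv⟩
    have hlen := congrArg Walk.length (p.take_spec hv)
    rw [Walk.length_append] at hlen
    have h₁ := G.edist_le (p.takeUntil v hv)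
    have h₂ := G.edist_le (p.dropUntil v hv)
    rw [← h, ← hlen] at hp
    lift G.edist x v to ℕ using ne_top_of_le_ne_top (ENat.natCast_ne_top _) h₁ with a ha
    lift G.edist v y to ℕ using ne_top_of_le_ne_top (ENat.natCast_ne_top _) h₂ with b hb
    norm_cast at h₁ h₂ hp
    refine ⟨⟨⟨p.takeUntil v hv, ?_⟩, ⟨p.dropUntil v hv, ?_⟩⟩, Subtype.ext (p.take_spec hv)⟩
    · rw [← ha]; norm_cast; omega
    · rw [← hb]; norm_cast; omega

theorem numSPthrough_eq_zero {x y v : V}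
    (h : G.edist x v + G.edist v y ≠ G.edist x y) : numSPthrough G x y v = 0 := by
  classical
  have : IsEmpty {p : G.Walk x y // (p.length : ℕ∞) = G.edist x y ∧ v ∈ p.support} := by
    refine ⟨fun ⟨p, hp, hv⟩ => h (le_antisymm ?_ G.edist_triangle)⟩
    rw [← hp, ← p.take_spec hv, Walk.length_append, Nat.cast_add]
    exact add_le_add (G.edist_le _) (G.edist_le _)
  exact Nat.card_of_isEmpty

open scoped Classical in
theorem numSP_eq_sum_adj [Fintype V] {v t : V} (hvt : v ≠ t) :
    numSP G v t =
      ∑ w with G.Adj v w ∧ G.edist v t = G.edist w t + 1, numSP G w t := by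
  have hfin := fun w => finite_shortestPaths G w t
  rw [← Finset.sum_coe_sort]
  simp only [numSP]
  rw [← Nat.card_sigma]
  symm
  refine Nat.card_eq_of_bijective
    (fun wp => ⟨Walk.cons (Finset.mem_filter.1 wp.1.2).2.1 wp.2.1, by
      rw [Walk.length_cons, Nat.cast_add, wp.2.2, Nat.cast_one]
      exact (Finset.mem_filter.1 wp.1.2).2.2.symm⟩) ⟨?_, ?_⟩
  · rintro ⟨⟨w, hw⟩, ⟨p, hp⟩⟩ ⟨⟨w', hw'⟩, ⟨p', hp'⟩⟩ heq
    have heq := congrArg Subtype.val heq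
    simp only [Walk.cons.injEq] at heq
    obtain ⟨rfl, heq⟩ := heq
    obtain rfl := eq_of_heq heq
    rfl
  · rintro ⟨p, hp⟩
    cases p with
    | nil => exact (hvt rfl).elim
    | @cons _ w _ hadj q =>
      have h₁ := G.edist_le q
      have h₂ : G.edist v t ≤ G.edist w t + 1 := by
        rw [add_comm, ← edist_eq_one_iff_adj.2 hadj]
        exact G.edist_triangle
      have hq : (q.length : ℕ∞) = G.edist w t := by
        refine le_antisymm ?_ h₁
        rw [← hp, Walk.length_cons, Nat.cast_add, Nat.cast_one] at h₂
        exact (ENat.add_le_add_iff_right ENat.one_ne_top).1 h₂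
      refine ⟨⟨⟨w, Finset.mem_filter.2 ⟨Finset.mem_univ _, hadj, ?_⟩⟩, ⟨q, hq⟩⟩, rfl⟩
      rw [← hp, ← hq, Walk.length_cons, Nat.cast_add, Nat.cast_one]

theorem edist_succ_and_edist_add_iff {s v w t : V} (hv : G.Reachable s v)
    (ht : G.Reachable s t) (hadj : G.Adj v w) :
    (G.edist v t = G.edist w t + 1 ∧ G.edist s v + G.edist v t = G.edist s t) ↔
      (G.edist s w = G.edist s v + 1 ∧ G.edist s w + G.edist w t = G.edist s t) := by
  have hw : G.Reachable s w := hv.trans hadj.reachable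
  have hvt : G.Reachable v t := hv.symm.trans ht
  have hwt : G.Reachable w t := hw.symm.trans ht
  have h₁ := hvt.dist_triangle_right s
  have h₂ := hwt.dist_triangle_right s
  have h₃ := hadj.reachable.dist_triangle_right s
  have h₄ := hwt.dist_triangle_right v
  rw [dist_eq_one_iff_adj.2 hadj] at h₃ h₄
  simp only [← Reachable.coe_dist_eq_edist, hv, ht, hw, hvt, hwt]
  norm_cast
  omega

open scoped Classical in
theorem numSPthrough_eq_sum [Fintype V] {s v t : V} (hv : G.Reachable s v)
    (ht : G.Reachable s t) (hvt : v ≠ t) :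
    (numSPthrough G s t v : ℚ) =
      ∑ w with G.Adj v w ∧ G.edist s w = G.edist s v + 1,
        (numSP G s v : ℚ) / (numSP G s w : ℚ) * numSPthrough G s t w := by
  have hterm : ∀ w, G.Adj v w ∧ G.edist s w = G.edist s v + 1 →
      (numSP G s v : ℚ) / (numSP G s w : ℚ) * numSPthrough G s t w =
        if G.edist s w + G.edist w t = G.edist s t
          then (numSP G s v : ℚ) * numSP G w t else 0 := by
    intro w hw
    have hpos := numSP_pos G (hv.trans hw.1.reachable)
    split_ifs with h
    · rw [numSPthrough_eq_mul G h]
      push_cast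
      field_simp
    · simp [numSPthrough_eq_zero G h]
  rw [Finset.sum_congr rfl fun w hw => hterm w (Finset.mem_filter.1 hw).2,
    ← Finset.sum_filter, Finset.filter_filter]
  by_cases h : G.edist s v + G.edist v t = G.edist s t
  · rw [numSPthrough_eq_mul G h, numSP_eq_sum_adj G hvt]
    push_cast
    rw [Finset.mul_sum]
    refine Finset.sum_congr (Finset.filter_congr fun w _ => ?_) fun _ _ => rfl
    rw [and_assoc]
    refine and_congr_right fun hadj => ?_
    rw [← edist_succ_and_edist_add_iff G hv ht hadj, and_iff_left h]
  · rw [numSPthrough_eq_zero G h, Finset.filter_false_of_mem, Finset.sum_empty, Nat.cast_zero]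
    rintro w - ⟨⟨hadj, h₁⟩, h₂⟩
    exact h ((edist_succ_and_edist_add_iff G hv ht hadj).2 ⟨h₁, h₂⟩).2

theorem reachable_of_numSP_pos {x y : V} (h : 0 < numSP G x y) : G.Reachable x y :=
  ⟨(Nat.card_pos_iff.1 h).1.some.1⟩

open scoped Classical in
theorem one_add_dep [Fintype V] {s w : V} (hws : w ≠ s) (hw : G.Reachable s w) :
    1 + dep G s w = ∑ t, if t ≠ s ∧ 0 < numSP G s t
      then (numSPthrough G s t w : ℚ) / (numSP G s t : ℚ) else 0 := by
  have hpos := numSP_pos G hw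
  rw [dep, ← Finset.add_sum_erase _ _ (Finset.mem_univ w),
    ← Finset.add_sum_erase _ _ (Finset.mem_univ w), if_neg (by simp), zero_add,
    if_pos ⟨hws, hpos⟩, numSPthrough_end, div_self (by exact_mod_cast hpos.ne')]
  congr 1
  refine Finset.sum_congr rfl fun t ht => ?_
  have htw := Finset.ne_of_mem_erase ht
  rw [numSPviaV_eq_numSPthrough G hws htw.symm]
  simp [htw]

end ShortestPathCounting

open scoped Classical in
/-- Brandes' dependency recursion: for `v ≠ s` reachable from `s`,
`δ_s(v) = Σ_w (σ(s,v)/σ(s,w))·(1 + δ_s(w))`, the sum ranging over the neighbors `w` of `v`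
with `edist(s,w) = edist(s,v) + 1`. -/
theorem stmt_11 {V : Type*} (G : SimpleGraph V) [Fintype V] (s v : V)
    (hvs : v ≠ s) (hreach : G.Reachable s v) :
    dep G s v =
      ∑ w ∈ Finset.univ.filter
          (fun w => G.Adj v w ∧ G.edist s w = G.edist s v + 1),
        (numSP G s v : ℚ) / (numSP G s w : ℚ) * (1 + dep G s w) := by
  have hsucc : ∀ w ∈ Finset.univ.filter
      (fun w => G.Adj v w ∧ G.edist s w = G.edist s v + 1),
      w ≠ s ∧ G.Reachable s w ∧ numSPthrough G s v w = 0 := by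
    intro w hw
    obtain ⟨hadj, hd⟩ := (Finset.mem_filter.1 hw).2
    have hne : G.edist s v ≠ ⊤ := edist_ne_top_iff_reachable.2 hreach
    refine ⟨?_, hreach.trans hadj.reachable, numSPthrough_eq_zero G ?_⟩
    · rintro rfl
      rw [edist_self] at hd
      simpa using hd.symm
    · rw [hd, add_assoc]
      intro h
      have h := ENat.add_right_injective_of_ne_top hne (h.trans (add_zero _).symm)
      simp at h
  rw [Finset.sum_congr rfl fun w hw => by
    rw [one_add_dep G (hsucc w hw).1 (hsucc w hw).2.1, Finset.mul_sum], Finset.sum_comm, dep]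
  refine Finset.sum_congr rfl fun t _ => ?_
  by_cases hts : t ≠ s ∧ 0 < numSP G s t
  · simp only [if_pos hts]
    by_cases htv : t = v
    · subst htv
      rw [if_neg (by simp)]
      refine (Finset.sum_eq_zero fun w hw => ?_).symm
      simp [(hsucc w hw).2.2]
    · rw [if_pos ⟨hts.1, htv, hts.2⟩, numSPviaV_eq_numSPthrough G hvs (Ne.symm htv),
        numSPthrough_eq_sum G hreach (reachable_of_numSP_pos G hts.2) (Ne.symm htv),
        Finset.sum_div]
      exact Finset.sum_congr rfl fun w _ => mul_div_assoc _ _ _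
  · rw [if_neg fun h => hts ⟨h.1, h.2.2⟩]
    simp [if_neg hts]
end

section
/- Let G be a simple graph, let s be a vertex, and let e = {u_H, u_L} be an edge of G with edist_G(s,u_H) finite and edist_G(s,u_L) = edist_G(s,u_H) + 1. Suppose there exists a vertex w ≠ u_H adjacent to u_L with edist_G(s,w) = edist_G(s,u_H). Let G' = G − e. Then for every vertex t, edist_{G'}(s,t) = edist_G(s,t). -/
open SimpleGraph

/-- A vertex at distance `n + 1` from `s` has a neighbor at distance `n` from `s`. -/
theorem exists_adj_edist_eq_of_edist_eq_add_one {V : Type*} {G : SimpleGraph V} {s t : V} {n : ℕ}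
    (h : G.edist s t = n + 1) : ∃ v, G.Adj v t ∧ G.edist s v = n := by
  obtain ⟨p, hp⟩ := exists_walk_of_edist_eq_coe (k := n + 1) (by rw [edist_comm, h]; norm_cast)
  cases p with
  | nil => simp at hp
  | cons hadj q =>
    rename_i v
    refine ⟨v, hadj.symm, le_antisymm ?_ ?_⟩
    · rw [edist_comm]
      refine (edist_le q).trans ?_
      rw [Walk.length_cons] at hp
      exact_mod_cast (Nat.succ_injective hp).le
    · have htri := G.edist_triangle (u := s) (v := v) (w := t)
      rw [h, edist_eq_one_iff_adj.mpr hadj.symm] at htri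
      exact (ENat.add_le_add_iff_right ENat.one_ne_top).mp htri

/-- If every vertex at positive finite `G`-distance from `s` has an `H`-neighbor that is one step
closer to `s` in `G`, then `H`-distances from `s` are at most `G`-distances. -/
theorem edist_le_edist_of_forall_exists_adj {V : Type*} {G H : SimpleGraph V} {s : V}
    (h : ∀ (t : V) (n : ℕ), G.edist s t = n + 1 → ∃ v, H.Adj v t ∧ G.edist s v = n) (t : V) :
    H.edist s t ≤ G.edist s t := by
  have key : ∀ (n : ℕ) (t : V), G.edist s t = n → H.edist s t ≤ n := by
    intro n
    induction n with
    | zero =>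
      intro t ht
      obtain rfl : s = t := edist_eq_zero_iff.mp (ht.trans Nat.cast_zero)
      simp
    | succ n ih =>
      intro t ht
      obtain ⟨v, hadj, hv⟩ := h t n (by exact_mod_cast ht)
      refine (H.edist_triangle (v := v)).trans ?_
      rw [edist_eq_one_iff_adj.mpr hadj, Nat.cast_succ]
      gcongr
      exact ih v hv
  by_cases ht : G.edist s t = ⊤
  · simp [ht]
  · obtain ⟨n, hn⟩ := ENat.ne_top_iff_exists.mp ht
    rw [← hn]
    exact key n t hn.symm

/-- Removing an edge `{u_H,u_L}` with `edist(s,u_L) = edist(s,u_H) + 1` (the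
latter finite), where `u_L` has another neighbor `w ≠ u_H` at distance `edist(s,u_H)` from
`s`, does not change any distance from `s`. -/
theorem stmt_14 {V : Type*} (G : SimpleGraph V) (s uH uL : V)
    (hadj : G.Adj uH uL)
    (hH : G.edist s uH ≠ ⊤) (hL : G.edist s uL = G.edist s uH + 1)
    (hpred : ∃ w : V, w ≠ uH ∧ G.Adj w uL ∧ G.edist s w = G.edist s uH) :
    ∀ t : V, (G.deleteEdges {s(uH, uL)}).edist s t = G.edist s t := by
  obtain ⟨w, hw, hwadj, hws⟩ := hpred
  intro t
  refine le_antisymm (edist_le_edist_of_forall_exists_adj ?_ t)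
    (edist_anti (deleteEdges_le _))
  intro t n ht
  obtain ⟨v, hadj', hv⟩ := exists_adj_edist_eq_of_edist_eq_add_one ht
  by_cases he : s(v, t) = s(uH, uL)
  · rcases Sym2.eq_iff.mp he with ⟨rfl, rfl⟩ | ⟨rfl, rfl⟩
    · exact ⟨w, by simp [deleteEdges_adj, hwadj, hw, hadj'.ne'], hws.trans hv⟩
    · rw [hv, ht] at hL
      norm_cast at hL
      omega
  · exact ⟨v, deleteEdges_adj.mpr ⟨hadj', he⟩, hv⟩
end

section
/- Let G be a simple graph, let s be a vertex, and let a, b be distinct nonadjacent vertices such that a is reachable from s in G and b is not reachable from s in G. Let G' = G + {a,b}. Then for every vertex t that is not reachable from s in G: edist_{G'}(s,t) = edist_G(s,a) + 1 + edist_G(b,t) (in ℕ∞), and σ_{G'}(s,t) = σ_G(s,a) · σ_G(b,t). -/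
open SimpleGraph

theorem le_addEdge {V : Type*} (G : SimpleGraph V) (a b : V) : G ≤ addEdge G a b :=
  le_sup_left

theorem addEdge_adj {V : Type*} {G : SimpleGraph V} {a b : V} (hne : a ≠ b) :
    (addEdge G a b).Adj a b :=
  Or.inr (by simp [SimpleGraph.edge_adj, hne])

/-- The walk in `addEdge G a b` that follows `p` to `a`, crosses to `b`, and follows `q`. -/
def glueWalk {V : Type*} {G : SimpleGraph V} {s a b t : V} (hne : a ≠ b)
    (p : G.Walk s a) (q : G.Walk b t) : (addEdge G a b).Walk s t :=
  (p.mapLe (le_addEdge G a b)).append (.cons (addEdge_adj hne) (q.mapLe (le_addEdge G a b)))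

theorem length_glueWalk {V : Type*} {G : SimpleGraph V} {s a b t : V} (hne : a ≠ b)
    (p : G.Walk s a) (q : G.Walk b t) :
    (glueWalk hne p q).length = p.length + 1 + q.length := by
  simp only [glueWalk, Walk.length_append, Walk.length_cons, Walk.length_map]
  omega

theorem support_glueWalk {V : Type*} {G : SimpleGraph V} {s a b t : V} (hne : a ≠ b)
    (p : G.Walk s a) (q : G.Walk b t) :
    (glueWalk hne p q).support = p.support ++ q.support := by
  simp [glueWalk, Walk.support_append]

theorem glueWalk_injective {V : Type*} {G : SimpleGraph V} {s a b t : V} (hne : a ≠ b)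
    {p p' : G.Walk s a} {q q' : G.Walk b t} (hlen : p.length = p'.length)
    (h : glueWalk hne p q = glueWalk hne p' q') : p = p' ∧ q = q' := by
  have hs := congrArg Walk.support h
  rw [support_glueWalk, support_glueWalk] at hs
  obtain ⟨hp, hq⟩ := List.append_inj hs (by simp [hlen])
  exact ⟨Walk.ext_support hp, Walk.ext_support hq⟩

/-- A walk of `addEdge G a b` ending outside the component of `a` can be replaced by a walk that is
no longer and crosses `{a, b}` exactly once or never, according to whether it starts in the
component of `a`; it is that walk if the lengths agree. -/
theorem exists_glueWalk {V : Type*} {G : SimpleGraph V} {a b x t : V} (hne : a ≠ b)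
    (hab : ¬ G.Reachable a b) (hat : ¬ G.Reachable a t) (r : (addEdge G a b).Walk x t) :
    (G.Reachable a x → ∃ (p : G.Walk x a) (q : G.Walk b t),
      p.length + 1 + q.length ≤ r.length ∧
      (p.length + 1 + q.length = r.length → glueWalk hne p q = r)) ∧
    (¬ G.Reachable a x → ∃ q : G.Walk x t, q.length ≤ r.length ∧
      (q.length = r.length → q.mapLe (le_addEdge G a b) = r)) := by
  induction r with
  | nil => exact ⟨fun h => absurd h hat, fun _ => ⟨.nil, by simp, fun _ => rfl⟩⟩
  | @cons x y t h r ih =>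
    obtain ⟨ih₁, ih₂⟩ := ih hat
    have hadj : G.Adj x y ∨ (x = a ∧ y = b) ∨ (x = b ∧ y = a) := by
      rcases h with h | h
      · exact .inl h
      · right; simpa [SimpleGraph.edge_adj, hne] using (SimpleGraph.edge_adj ..).1 h |>.1
    rcases hadj with hG | ⟨rfl, rfl⟩ | ⟨rfl, rfl⟩
    · refine ⟨fun hx => ?_, fun hx => ?_⟩
      · obtain ⟨p, q, hle, heq⟩ := ih₁ (hx.trans hG.reachable)
        refine ⟨.cons hG p, q, by simp only [Walk.length_cons]; omega, fun he => ?_⟩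
        rw [← heq (by simp only [Walk.length_cons] at he; omega)]
        rfl
      · obtain ⟨q, hle, heq⟩ := ih₂ fun hy => hx (hy.trans hG.symm.reachable)
        refine ⟨.cons hG q, by simpa using hle, fun he => ?_⟩
        rw [← heq (by simpa using he)]
        rfl
    · refine ⟨fun _ => ?_, fun hx => absurd (.refl _) hx⟩
      obtain ⟨q, hle, heq⟩ := ih₂ hab
      refine ⟨.nil, q, by simp only [Walk.length_cons, Walk.length_nil]; omega, fun he => ?_⟩
      rw [← heq (by simp only [Walk.length_cons, Walk.length_nil] at he; omega)]
      rfl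
    · refine ⟨fun hx => absurd hx hab, fun _ => ?_⟩
      obtain ⟨p, q, hle, -⟩ := ih₁ (.refl _)
      exact ⟨q, by simp only [Walk.length_cons]; omega,
        fun he => by simp only [Walk.length_cons] at he; omega⟩

theorem edist_addEdge {V : Type*} {G : SimpleGraph V} {s a b t : V} (hne : a ≠ b)
    (hra : G.Reachable s a) (hab : ¬ G.Reachable a b) (hat : ¬ G.Reachable a t) :
    (addEdge G a b).edist s t = G.edist s a + 1 + G.edist b t := by
  apply le_antisymm
  · calc (addEdge G a b).edist s t
        ≤ (addEdge G a b).edist s b + (addEdge G a b).edist b t := SimpleGraph.edist_triangle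
      _ ≤ (addEdge G a b).edist s a + (addEdge G a b).edist a b + (addEdge G a b).edist b t := by
          gcongr; exact SimpleGraph.edist_triangle
      _ ≤ G.edist s a + 1 + G.edist b t := by
          gcongr
          · exact le_addEdge G a b
          · exact (edist_eq_one_iff_adj.2 (addEdge_adj hne)).le
          · exact le_addEdge G a b
  · refine le_iInf fun r => ?_
    obtain ⟨p, q, hle, -⟩ := (exists_glueWalk hne hab hat r).1 hra.symm
    calc G.edist s a + 1 + G.edist b t ≤ p.length + 1 + q.length := by
          gcongr <;> exact edist_le _
      _ ≤ r.length := by exact_mod_cast hle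

theorem numSP_addEdge {V : Type*} {G : SimpleGraph V} {s a b t : V} (hne : a ≠ b)
    (hra : G.Reachable s a) (hab : ¬ G.Reachable a b) (hat : ¬ G.Reachable a t) :
    numSP (addEdge G a b) s t = numSP G s a * numSP G b t := by
  have hd := edist_addEdge hne hra hab hat
  unfold numSP
  rw [← Nat.card_prod]
  symm
  refine Nat.card_congr (Equiv.ofBijective (fun pq => ⟨glueWalk hne pq.1.1 pq.2.1, ?_⟩) ⟨?_, ?_⟩)
  · obtain ⟨⟨p, hp⟩, q, hq⟩ := pq
    simp [hd, length_glueWalk, ← hp, ← hq]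
  · rintro ⟨⟨p, hp⟩, q, hq⟩ ⟨⟨p', hp'⟩, q', hq'⟩ h
    obtain ⟨rfl, rfl⟩ := glueWalk_injective hne (by exact_mod_cast hp.trans hp'.symm)
      (Subtype.ext_iff.1 h)
    rfl
  · rintro ⟨r, hr⟩
    obtain ⟨p, q, hle, heq⟩ := (exists_glueWalk hne hab hat r).1 hra.symm
    have hp := edist_le p
    have hq := edist_le q
    rw [hd] at hr
    obtain ⟨m, hm⟩ := ENat.ne_top_iff_exists.1 (ne_top_of_le_ne_top (ENat.natCast_ne_top _) hp)
    obtain ⟨n, hn⟩ := ENat.ne_top_iff_exists.1 (ne_top_of_le_ne_top (ENat.natCast_ne_top _) hq)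
    rw [← hm] at hp hr
    rw [← hn] at hq hr
    norm_cast at hp hq hr
    refine ⟨⟨⟨p, ?_⟩, q, ?_⟩, Subtype.ext (heq (by omega))⟩
    · rw [← hm]; norm_cast; omega
    · rw [← hn]; norm_cast; omega

/-- If `a` is reachable from `s` in `G` but `b` is not, then after adding the
edge `{a,b}`, every vertex `t` not reachable from `s` in `G` satisfies
`edist'(s,t) = edist(s,a) + 1 + edist(b,t)` and `σ'(s,t) = σ(s,a)·σ(b,t)`. -/
theorem stmt_17 {V : Type*} (G : SimpleGraph V) (s a b : V)
    (hne : a ≠ b) (hnadj : ¬ G.Adj a b)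
    (hra : G.Reachable s a) (hrb : ¬ G.Reachable s b) :
    ∀ t : V, ¬ G.Reachable s t →
      (addEdge G a b).edist s t = G.edist s a + 1 + G.edist b t ∧
      numSP (addEdge G a b) s t = numSP G s a * numSP G b t := by
  intro t ht
  have hab : ¬ G.Reachable a b := fun h => hrb (hra.trans h)
  have hat : ¬ G.Reachable a t := fun h => ht (hra.trans h)
  exact ⟨edist_addEdge hne hra hab hat, numSP_addEdge hne hra hab hat⟩
end

section
/- Let G be a simple graph, let s be a vertex, and let u_H, u_L be distinct nonadjacent vertices with edist_G(s,u_H) finite and edist_G(s,u_H) + 1 < edist_G(s,u_L) (in ℕ∞, so u_L may also be unreachable from s). Let G' = G + {u_H,u_L}. Then for every vertex w: edist_{G'}(s,w) = min( edist_G(s,w), edist_G(s,u_H) + 1 + edist_G(u_L,w) ) in ℕ∞; in particular, if edist_{G'}(s,w) ≠ edist_G(s,w) then w is reachable from u_L in G and edist_{G'}(s,w) = edist_G(s,u_H) + 1 + edist_G(u_L,w). -/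
open SimpleGraph

/-- A function growing by at most one along every edge grows by at most the extended distance. -/
theorem SimpleGraph.le_add_edist_of_adj {V : Type*} {G : SimpleGraph V} (f : V → ℕ∞)
    (hf : ∀ u v, G.Adj u v → f v ≤ f u + 1) (u v : V) : f v ≤ f u + G.edist u v := by
  have walk_bound : ∀ {x y : V} (p : G.Walk x y), f y ≤ f x + p.length := by
    intro x y p
    induction p with
    | nil => simp
    | cons h p ih =>
      refine ih.trans ((add_le_add_left (hf _ _ h) _).trans (le_of_eq ?_))
      rw [Walk.length_cons]
      push_cast
      ring
  by_cases h : G.edist u v = ⊤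
  · simp [h]
  · obtain ⟨p, hp⟩ := exists_walk_of_edist_ne_top h
    exact hp ▸ walk_bound p

theorem SimpleGraph.Adj.edist_le_edist_add_one {V : Type*} {G : SimpleGraph V} {u v : V}
    (h : G.Adj u v) (x : V) : G.edist x v ≤ G.edist x u + 1 :=
  G.edist_triangle.trans (add_le_add_right (edist_eq_one_iff_adj.2 h).le _)

theorem edist_addEdge_le {V : Type*} (G : SimpleGraph V) {a b : V} (hne : a ≠ b) (s w : V) :
    (addEdge G a b).edist s w ≤ min (G.edist s w) (G.edist s a + 1 + G.edist b w) := by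
  have hle : G ≤ addEdge G a b := le_sup_left
  have hadj : (addEdge G a b).Adj a b := Or.inr (by simp [edge_adj, hne])
  refine le_min (edist_anti hle) ?_
  calc (addEdge G a b).edist s w
      ≤ (addEdge G a b).edist s b + (addEdge G a b).edist b w := SimpleGraph.edist_triangle
    _ ≤ (addEdge G a b).edist s a + 1 + (addEdge G a b).edist b w :=
      add_le_add_left (hadj.edist_le_edist_add_one s) _
    _ ≤ G.edist s a + 1 + G.edist b w := by gcongr

theorem le_edist_addEdge {V : Type*} (G : SimpleGraph V) {s a b : V}
    (hab : G.edist s a ≤ G.edist s b + 1) (w : V) :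
    min (G.edist s w) (G.edist s a + 1 + G.edist b w) ≤ (addEdge G a b).edist s w := by
  have key := (addEdge G a b).le_add_edist_of_adj
    (fun x ↦ min (G.edist s x) (G.edist s a + 1 + G.edist b x)) ?_ s w
  · simpa using key
  intro x y h
  rw [min_add]
  rcases h with h | h
  · refine min_le_min (h.edist_le_edist_add_one s) ?_
    rw [add_assoc _ (G.edist b x)]
    exact add_le_add_right (h.edist_le_edist_add_one b) _
  · rw [edge_adj] at h
    rcases h.1 with ⟨rfl, rfl⟩ | ⟨rfl, rfl⟩
    · refine (min_le_right _ _).trans (le_min (by simp) ?_)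
      rw [edist_self, add_zero]
      exact add_le_add_left (le_self_add.trans le_self_add) _
    · refine (min_le_left _ _).trans (le_min hab ?_)
      exact le_self_add.trans (le_self_add.trans le_self_add)

/-- Adding an edge `{u_H,u_L}` with `edist(s,u_H) + 1 < edist(s,u_L)` (the
former finite): for every `w`, the new distance is
`min(edist(s,w), edist(s,u_H) + 1 + edist(u_L,w))`; in particular, if the distance from `s`
to `w` changed, then `w` is reachable from `u_L` in `G` and
`edist'(s,w) = edist(s,u_H) + 1 + edist(u_L,w)`. -/
theorem stmt_19 {V : Type*} (G : SimpleGraph V) (s uH uL : V)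
    (hne : uH ≠ uL) (hnadj : ¬ G.Adj uH uL)
    (hH : G.edist s uH ≠ ⊤) (hlt : G.edist s uH + 1 < G.edist s uL) :
    ∀ w : V,
      (addEdge G uH uL).edist s w =
        min (G.edist s w) (G.edist s uH + 1 + G.edist uL w) ∧
      ((addEdge G uH uL).edist s w ≠ G.edist s w →
        G.Reachable uL w ∧
        (addEdge G uH uL).edist s w = G.edist s uH + 1 + G.edist uL w) := by
  intro w
  have hab : G.edist s uH ≤ G.edist s uL + 1 := le_self_add.trans (hlt.le.trans le_self_add)
  have heq := (edist_addEdge_le G hne s w).antisymm (le_edist_addEdge G hab w)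
  refine ⟨heq, fun h ↦ ?_⟩
  have hw : G.edist s uH + 1 + G.edist uL w < G.edist s w := by
    by_contra! hle
    exact h (heq.trans (min_eq_left hle))
  refine ⟨reachable_of_edist_ne_top fun htop ↦ ?_, heq.trans (min_eq_right hw.le)⟩
  simp [htop] at hw
end
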